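/- If r ∈ ℝ admits a finite adequate set, then r is algebraic over ℚ. Together with the converse, ℝ̃ equals the field of real algebraic numbers. -/

import Mathlib

/-- A finite set `A` is adequate for `r`: it contains `r`, and every map `f`
preserving `1` (when `1 ∈ A`) and preserving sums/products lying in `A` fixes `r`. -/
def Adequate {K : Type*} [Field K] (A : Finset K) (r : K) : Prop :=
  r ∈ A ∧ ∀ f : K → K,
    ((1 : K) ∈ A → f 1 = 1) →
    (∀ a b : K, a ∈ A → b ∈ A → a + b ∈ A → f (a + b) = f a + f b) →
    (∀ a b : K, a ∈ A → b ∈ A → a * b ∈ A → f (a * b) = f a * f b) →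
    f r = r

open Filter Topology Polynomial IntermediateField
open scoped algebraAdjoinAdjoin

theorem exists_intermediateField_transcendental {K L : Type*} [Field K] [Field L] [Algebra K L]
    {r : L} (hr : Transcendental K r) :
    ∃ F : IntermediateField K L, Transcendental F r ∧ Algebra.IsAlgebraic F⟮r⟯ L := by
  obtain ⟨u, hu, hb⟩ := exists_isTranscendenceBasis_superset (R := K) (s := {r})
    ((algebraicIndependent_singleton_iff (⟨r, rfl⟩ : ({r} : Set L))).2 (by exact hr))
  refine ⟨adjoin K (u \ {r}), ?_, ?_⟩
  · have h := hb.1.transcendental_adjoin (s := {i | (i : L) ≠ r}) (i := ⟨r, hu rfl⟩) (by simp)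
    have e : ((↑) : u → L) '' {i | (i : L) ≠ r} = u \ {r} := by ext; simp [and_comm]
    rw [e] at h
    intro h'
    exact h ((IsFractionRing.isAlgebraic_iff (Algebra.adjoin K (u \ {r})) (adjoin K (u \ {r})) L).2 h')
  · have := hb.isAlgebraic_field
    rw [Subtype.range_coe] at this
    have hle : adjoin K u ≤ (adjoin K (u \ {r}))⟮r⟯.restrictScalars K := by
      rw [adjoin_adjoin_left]
      exact adjoin.mono _ _ _ (by simp)
    exact ⟨fun x ↦ IsAlgebraic.tower_top_of_subalgebra_le
      (A := (adjoin K u).toSubalgebra)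
      (B := ((adjoin K (u \ {r}))⟮r⟯.restrictScalars K).toSubalgebra) hle
      (Algebra.IsAlgebraic.isAlgebraic (R := adjoin K u) x)⟩

/-- The embedding of `F⟮r⟯` into `L` sending `r` to `s`, for `r` and `s` transcendental. -/
noncomputable def transcendentalHom {F L : Type*} [Field F] [Field L] [Algebra F L] {r s : L}
    (hr : Transcendental F r) (hs : Transcendental F s) : F⟮r⟯ →ₐ[F] L :=
  F⟮s⟯.val.comp ((RatFunc.algEquivOfTranscendental r hr).symm.trans
    (RatFunc.algEquivOfTranscendental s hs)).toAlgHom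

theorem transcendentalHom_gen {F L : Type*} [Field F] [Field L] [Algebra F L] {r s : L}
    (hr : Transcendental F r) (hs : Transcendental F s) :
    transcendentalHom hr hs (AdjoinSimple.gen F r) = s := by
  simp [transcendentalHom, RatFunc.algEquivOfTranscendental_symm_gen]

theorem tendsto_transcendentalHom {F L ι : Type*} [Field F] [Field L] [Algebra F L]
    [TopologicalSpace L] [IsTopologicalDivisionRing L] {r : L} {s : ι → L} {l : Filter ι}
    (hr : Transcendental F r) (hs : ∀ i, Transcendental F (s i)) (hl : Tendsto s l (𝓝 r))
    (x : F⟮r⟯) : Tendsto (fun i ↦ transcendentalHom hr (hs i) x) l (𝓝 (x : L)) := by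
  obtain ⟨u, rfl⟩ := (RatFunc.algEquivOfTranscendental r hr).surjective x
  have hd : aeval r u.denom ≠ 0 := fun h ↦ hr ⟨_, u.denom_ne_zero, h⟩
  have he (i) : transcendentalHom hr (hs i) (RatFunc.algEquivOfTranscendental r hr u) =
      aeval (s i) u.num / aeval (s i) u.denom := by
    rw [← RatFunc.algEquivOfTranscendental_apply (s i) (hs i)]
    simp [transcendentalHom]
  simp only [he, RatFunc.algEquivOfTranscendental_apply]
  exact ((u.num.continuous_aeval.tendsto r).comp hl).div
    ((u.denom.continuous_aeval.tendsto r).comp hl) hd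

theorem tendsto_eval₂ {R S ι : Type*} [Semiring R] [Semiring S] [TopologicalSpace S]
    [IsTopologicalSemiring S] {l : Filter ι} {φ : ι → R →+* S} {ψ : R →+* S}
    (h : ∀ x, Tendsto (fun i ↦ φ i x) l (𝓝 (ψ x))) (p : R[X]) (y : S) :
    Tendsto (fun i ↦ p.eval₂ (φ i) y) l (𝓝 (p.eval₂ ψ y)) := by
  simp only [eval₂_eq_sum, Polynomial.sum]
  exact tendsto_finsetSum _ fun i _ ↦ (h _).mul_const _

theorem exists_eval_mul_eval_neg {p : ℝ[X]} {x : ℝ} (hp : p.eval x = 0)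
    (hp' : p.derivative.eval x ≠ 0) : ∃ a b, p.eval a * p.eval b < 0 := by
  obtain ⟨g, rfl⟩ := dvd_iff_isRoot.2 hp
  have hg : g.eval x ≠ 0 := by simpa using hp'
  have hc : Continuous fun e ↦ g.eval (x + e) * g.eval (x - e) := by fun_prop
  have h0 : 0 < g.eval (x + 0) * g.eval (x - 0) := by
    simpa using mul_self_pos.2 hg
  obtain ⟨e, he, he0⟩ := (((hc.tendsto 0).mono_left nhdsWithin_le_nhds).eventually
    (lt_mem_nhds h0) |>.and (self_mem_nhdsWithin (s := Set.Ioi (0 : ℝ)))).exists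
  refine ⟨x + e, x - e, ?_⟩
  have := mul_pos (mul_pos he0 he0) he
  simp only [eval_mul, eval_sub, eval_X, eval_C]
  linarith

theorem exists_eval_eq_zero_of_mul_neg {p : ℝ[X]} {a b : ℝ} (h : p.eval a * p.eval b < 0) :
    ∃ y, p.eval y = 0 := by
  have : (0 : ℝ) ∈ Set.range fun y ↦ p.eval y := by
    rcases mul_neg_iff.1 h with h | h
    · exact mem_range_of_exists_le_of_exists_ge p.continuous ⟨b, h.2.le⟩ ⟨a, h.1.le⟩
    · exact mem_range_of_exists_le_of_exists_ge p.continuous ⟨a, h.1.le⟩ ⟨b, h.2.le⟩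
  exact this

/-- An embedding of a subfield into `ℝ` extends to a finite extension as soon as it is close
enough to the inclusion. -/
theorem eventually_exists_extension {E : Type*} [Field E] [Algebra E ℝ]
    [Algebra.IsAlgebraic E ℝ] {ι : Type*} {l : Filter ι}
    {φ : ι → E →+* ℝ} (h : ∀ x, Tendsto (fun i ↦ φ i x) l (𝓝 (algebraMap E ℝ x))) (A : Finset ℝ) :
    ∀ᶠ i in l, ∃ σ : adjoin E (A : Set ℝ) →+* ℝ, ∀ x, σ (algebraMap E _ x) = φ i x := by
  set M := adjoin E (A : Set ℝ)
  have : CharZero E := (algebraMap E ℝ).charZero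
  have : FiniteDimensional E M :=
    finiteDimensional_adjoin fun x _ ↦ (Algebra.IsAlgebraic.isAlgebraic x).isIntegral
  obtain ⟨θ, hθ⟩ := Field.exists_primitive_element E M
  have hint : IsIntegral E θ := .of_finite E θ
  set p := minpoly E θ
  have hroot : aeval θ p = 0 := minpoly.aeval E θ
  have hsep : aeval θ (derivative p) ≠ 0 :=
    (minpoly.irreducible hint).separable.aeval_derivative_ne_zero hroot
  obtain ⟨a, b, hab⟩ := exists_eval_mul_eval_neg (p := p.map (algebraMap E ℝ)) (x := (θ : ℝ))
    (by rw [eval_map_algebraMap, aeval_coe, hroot]; rfl)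
    (by rw [derivative_map, eval_map_algebraMap, aeval_coe]; exact_mod_cast hsep)
  simp only [eval_map] at hab
  filter_upwards [((tendsto_eval₂ h p a).mul (tendsto_eval₂ h p b)).eventually (gt_mem_nhds hab)]
    with i hi
  simp only [← eval_map] at hi
  obtain ⟨y, hy⟩ := exists_eval_eq_zero_of_mul_neg hi
  rw [eval_map] at hy
  let e : M ≃ₐ[E] AdjoinRoot p :=
    topEquiv.symm.trans ((equivOfEq hθ.symm).trans (adjoinRootEquivAdjoin E hint).symm)
  refine ⟨(AdjoinRoot.lift (φ i) y hy).comp e.toAlgHom.toRingHom, fun x ↦ ?_⟩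
  have : e (algebraMap E M x) = AdjoinRoot.of p x := e.commutes x
  simp [this]

theorem not_adequate_of_transcendental {r : ℝ} (hr : Transcendental ℚ r) (A : Finset ℝ) :
    ¬ Adequate A r := by
  rintro ⟨hrA, hA⟩
  obtain ⟨F, hF, _⟩ := exists_intermediateField_transcendental hr
  let s (n : ℕ) : ℝ := r + 1 / ((n : ℝ) + 1)
  have hs (n : ℕ) : Transcendental F (s n) := fun h ↦ hF <| by
    have hq : IsAlgebraic F (1 / ((n : ℝ) + 1)) := by
      simpa using isAlgebraic_algebraMap (R := F) (A := ℝ) (1 / ((n : F) + 1))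
    simpa [s] using h.sub hq
  have hl : Tendsto s atTop (𝓝 r) := by
    simpa [s] using tendsto_one_div_add_atTop_nhds_zero_nat.const_add r
  obtain ⟨n, σ, hσ⟩ := (eventually_exists_extension
    (φ := fun n ↦ (transcendentalHom hF (hs n) : F⟮r⟯ →+* ℝ))
    (tendsto_transcendentalHom hF hs hl) A).exists
  have hmem {x : ℝ} (hx : x ∈ A) : x ∈ adjoin F⟮r⟯ (A : Set ℝ) := subset_adjoin _ _ hx
  classical
  let f (x : ℝ) : ℝ := if hx : x ∈ adjoin F⟮r⟯ (A : Set ℝ) then σ ⟨x, hx⟩ else 0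
  have hf {x : ℝ} (hx : x ∈ adjoin F⟮r⟯ (A : Set ℝ)) : f x = σ ⟨x, hx⟩ := dif_pos hx
  have hfr : f r = s n := by
    rw [hf (hmem hrA), ← transcendentalHom_gen hF (hs n)]
    exact hσ (AdjoinSimple.gen F r)
  have := hA f (fun h1 ↦ by rw [hf (hmem h1)]; exact map_one σ)
    (fun a b ha hb hab ↦ by
      rw [hf (hmem ha), hf (hmem hb), hf (hmem hab), ← map_add]; rfl)
    (fun a b ha hb hab ↦ by
      rw [hf (hmem ha), hf (hmem hb), hf (hmem hab), ← map_mul]; rfl)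
  have hpos : 0 < 1 / ((n : ℝ) + 1) := by positivity
  simp only [hfr, s] at this
  linarith

/-- `f` preserves `1` and the sums and products lying in `A`. -/
def IsPartialHom {K : Type*} [Field K] (A : Finset K) (f : K → K) : Prop :=
  ((1 : K) ∈ A → f 1 = 1) ∧
    (∀ a b : K, a ∈ A → b ∈ A → a + b ∈ A → f (a + b) = f a + f b) ∧
    (∀ a b : K, a ∈ A → b ∈ A → a * b ∈ A → f (a * b) = f a * f b)

theorem IsPartialHom.mono {K : Type*} [Field K] {A B : Finset K} {f : K → K} (h : A ⊆ B)
    (hf : IsPartialHom B f) : IsPartialHom A f :=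
  ⟨fun h1 ↦ hf.1 (h h1), fun a b ha hb hab ↦ hf.2.1 a b (h ha) (h hb) (h hab),
    fun a b ha hb hab ↦ hf.2.2 a b (h ha) (h hb) (h hab)⟩

/-- The filter generated by the sets of partial homomorphisms on finite subsets. -/
def partialHomFilter (K : Type*) [Field K] : Filter (K → K) :=
  ⨅ A : Finset K, 𝓟 {f | IsPartialHom A f}

section

variable {K : Type*} [Field K]

theorem eventually_partialHomFilter {P : (K → K) → Prop} :
    (∀ᶠ f in partialHomFilter K, P f) ↔ ∃ A : Finset K, ∀ f, IsPartialHom A f → P f := by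
  classical
  rw [partialHomFilter, Filter.Eventually, mem_iInf_of_directed]
  · simp [Set.subset_def]
  · intro A B
    exact ⟨A ∪ B, by simpa using fun f ↦ IsPartialHom.mono Finset.subset_union_left,
      by simpa using fun f ↦ IsPartialHom.mono Finset.subset_union_right⟩

theorem exists_adequate_iff {r : K} :
    (∃ A : Finset K, Adequate A r) ↔ ∀ᶠ f in partialHomFilter K, f r = r := by
  classical
  rw [eventually_partialHomFilter]
  constructor
  · rintro ⟨A, -, hA⟩
    exact ⟨A, fun f hf ↦ hA f hf.1 hf.2.1 hf.2.2⟩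
  · rintro ⟨A, hA⟩
    exact ⟨insert r A, Finset.mem_insert_self _ _, fun f h1 h2 h3 ↦
      hA f (IsPartialHom.mono (Finset.subset_insert _ _) ⟨h1, h2, h3⟩)⟩

theorem eventually_map_one : ∀ᶠ f in partialHomFilter K, f 1 = 1 :=
  eventually_partialHomFilter.2 ⟨{1}, fun _ hf ↦ hf.1 (by simp)⟩

theorem eventually_map_add (a b : K) : ∀ᶠ f in partialHomFilter K, f (a + b) = f a + f b := by
  classical
  exact eventually_partialHomFilter.2 ⟨{a, b, a + b}, fun _ hf ↦
    hf.2.1 a b (by simp) (by simp) (by simp)⟩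

theorem eventually_map_mul (a b : K) : ∀ᶠ f in partialHomFilter K, f (a * b) = f a * f b := by
  classical
  exact eventually_partialHomFilter.2 ⟨{a, b, a * b}, fun _ hf ↦
    hf.2.2 a b (by simp) (by simp) (by simp)⟩

theorem eventually_map_zero : ∀ᶠ f in partialHomFilter K, f 0 = 0 := by
  filter_upwards [eventually_map_add (0 : K) 0] with f hf
  simpa using hf

theorem eventually_map_natCast (n : ℕ) : ∀ᶠ f in partialHomFilter K, f (n : K) = (n : K) := by
  induction n with
  | zero => simpa using eventually_map_zero (K := K)
  | succ n ih =>
    filter_upwards [ih, eventually_map_one, eventually_map_add (n : K) 1] with f h1 h2 h3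
    rw [Nat.cast_succ, h3, h1, h2]

theorem eventually_map_sub (a b : K) : ∀ᶠ f in partialHomFilter K, f (a - b) = f a - f b := by
  filter_upwards [eventually_map_add (a - b) b] with f h
  rw [sub_add_cancel] at h
  exact eq_sub_of_add_eq h.symm

theorem eventually_map_intCast (n : ℤ) : ∀ᶠ f in partialHomFilter K, f (n : K) = (n : K) := by
  have e : (n : K) = (n.toNat : K) - ((-n).toNat : K) := by
    exact_mod_cast (congrArg (Int.cast : ℤ → K) n.toNat_sub_toNat_neg).symm
  filter_upwards [eventually_map_natCast (K := K) n.toNat,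
    eventually_map_natCast (K := K) (-n).toNat,
    eventually_map_sub (n.toNat : K) ((-n).toNat : K)] with f h1 h2 h3
  rw [e, h3, h1, h2]

theorem eventually_map_ratCast [CharZero K] (q : ℚ) :
    ∀ᶠ f in partialHomFilter K, f (q : K) = (q : K) := by
  have hd : (q.den : K) ≠ 0 := by exact_mod_cast q.den_ne_zero
  have hq : (q : K) * q.den = q.num := by exact_mod_cast q.mul_den_eq_num
  filter_upwards [eventually_map_natCast (K := K) q.den, eventually_map_intCast (K := K) q.num,
    eventually_map_mul (q : K) q.den] with f h1 h2 h3
  rw [hq, h2, h1, ← hq] at h3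
  exact (mul_right_cancel₀ hd h3).symm

theorem eventually_map_aeval [CharZero K] (p : ℚ[X]) (x : K) :
    ∀ᶠ f in partialHomFilter K, f (aeval x p) = aeval (f x) p := by
  induction p using Polynomial.induction_on with
  | C a => simpa using eventually_map_ratCast (K := K) a
  | add p q hp hq =>
    filter_upwards [hp, hq, eventually_map_add (aeval x p) (aeval x q)] with f h1 h2 h3
    rw [map_add, h3, h1, h2, map_add]
  | monomial n a h =>
    filter_upwards [h, eventually_map_mul (aeval x (C a * X ^ n)) x] with f h1 h2
    rw [pow_succ, ← mul_assoc, map_mul, map_mul _ _ X, aeval_X, aeval_X, h2, h1]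

end

theorem eventually_map_mono {a b : ℝ} (hab : a ≤ b) :
    ∀ᶠ f in partialHomFilter ℝ, f a ≤ f b := by
  filter_upwards [eventually_map_sub b a, eventually_map_mul √(b - a) √(b - a)] with f h1 h2
  rw [Real.mul_self_sqrt (sub_nonneg.2 hab), h1] at h2
  exact sub_nonneg.1 (h2 ▸ mul_self_nonneg _)

theorem eventually_map_eq_of_isAlgebraic {r : ℝ} (hr : IsAlgebraic ℚ r) :
    ∀ᶠ f in partialHomFilter ℝ, f r = r := by
  obtain ⟨p, hp, hpr⟩ := hr
  have hopen : IsOpen ((p.rootSet ℝ \ {r})ᶜ) :=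
    ((p.rootSet_finite ℝ).subset Set.sdiff_subset).isClosed.isOpen_compl
  obtain ⟨ε, hε, hball⟩ := Metric.isOpen_iff.1 hopen r (by simp)
  obtain ⟨a, ha, har⟩ := exists_rat_btwn (sub_lt_self r hε)
  obtain ⟨b, hrb, hb⟩ := exists_rat_btwn (lt_add_of_pos_right r hε)
  filter_upwards [eventually_map_aeval p r, eventually_map_zero (K := ℝ),
    eventually_map_ratCast (K := ℝ) a, eventually_map_ratCast (K := ℝ) b,
    eventually_map_mono har.le, eventually_map_mono hrb.le]
    with f h1 h2 h3 h4 h5 h6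
  rw [hpr, h2] at h1
  by_contra hne
  refine hball (a := f r) ?_ ⟨(mem_rootSet.2 ⟨hp, h1.symm⟩), hne⟩
  rw [Metric.mem_ball, Real.dist_eq, abs_lt]
  constructor <;> linarith

/-- If r ∈ ℝ admits a finite adequate set then r is algebraic over ℚ; hence
ℝ̃ is the field of real algebraic numbers. -/
theorem tilde_real_eq_algebraic :
    (∀ r : ℝ, (∃ A : Finset ℝ, Adequate A r) → IsAlgebraic ℚ r) ∧
    {r : ℝ | ∃ A : Finset ℝ, Adequate A r} = {r : ℝ | IsAlgebraic ℚ r} := by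
  have key (r : ℝ) (h : ∃ A : Finset ℝ, Adequate A r) : IsAlgebraic ℚ r := by
    obtain ⟨A, hA⟩ := h
    by_contra hr
    exact not_adequate_of_transcendental hr A hA
  exact ⟨key, Set.ext fun r ↦
    ⟨key r, fun hr ↦ exists_adequate_iff.2 (eventually_map_eq_of_isAlgebraic hr)⟩⟩
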